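/- Let π be a balanced partition of the player set N, and let a : N → M be an outcome such that for every block C ∈ π: if m divides |C| then every resource is chosen by exactly |C|/m players of C, and if |C| < m then no resource is chosen by more than one player of C. Then a is evenly distributed, i.e., |n_x(a) − n_y(a)| ≤ 1 for all resources x, y ∈ M; consequently a minimizes both the total cost c̄ and the maximum cost ĉ over all outcomes. -/

import Mathlib

/-- The load of resource `x` under outcome `a`: the number of players choosing `x`. -/
def load {N M : Type*} [Fintype N] [DecidableEq M] (a : N → M) (x : M) : ℕ :=
  (Finset.univ.filter fun i => a i = x).card

/-- The total cost of an outcome. -/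
def totalCost {N M : Type*} [Fintype N] [DecidableEq M] (f : ℕ → ℚ) (a : N → M) : ℚ :=
  ∑ i, f (load a (a i))

/-- The maximum cost incurred by any player under outcome `a`. -/
def maxCost {N M : Type*} [Fintype N] [Nonempty N] [DecidableEq M]
    (f : ℕ → ℚ) (a : N → M) : ℚ :=
  Finset.univ.sup' Finset.univ_nonempty fun i => f (load a (a i))

/-- A sequence with nondecreasing increments lies above each of its secants through
consecutive points. -/
lemma secant_le_of_monotone_increments {g : ℕ → ℚ} (hg : Monotone fun k => g (k + 1) - g k)
    (q k : ℕ) : g q + ((k : ℚ) - q) * (g (q + 1) - g q) ≤ g k := by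
  rcases le_total q k with h | h
  · induction k, h using Nat.le_induction with
    | base => simp
    | succ k hk ih =>
      have h1 : g (q + 1) - g q ≤ g (k + 1) - g k := hg hk
      push_cast
      linarith
  · induction h using Nat.decreasingInduction with
    | self => simp
    | of_succ k hk ih =>
      have h1 : g (k + 1) - g k ≤ g (q + 1) - g q := hg hk.le
      push_cast at ih
      linarith

/-- If `f` is increasing and convex, then `k ↦ k * f k` has nondecreasing increments. -/
lemma monotone_increments_mul_self {f : ℕ → ℚ} (hf_mono : ∀ k, f k < f (k + 1))
    (hf_conv : ∀ k, f (k + 1) - f k ≤ f (k + 2) - f (k + 1)) :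
    Monotone fun k : ℕ => ((k + 1 : ℕ) : ℚ) * f (k + 1) - (k : ℚ) * f k := by
  refine monotone_nat_of_le_succ fun k => ?_
  have h := mul_le_mul_of_nonneg_left (hf_conv k) (Nat.cast_nonneg (α := ℚ) k)
  have h1 := hf_mono (k + 1)
  have h2 := hf_mono k
  push_cast
  simp only [add_assoc, one_add_one_eq_two] at *
  linarith

section Load

variable {N M : Type*} [Fintype N] [DecidableEq M]

/-- The loads add up to the number of players. -/
lemma sum_load [Fintype M] (a : N → M) : ∑ x, load a x = Fintype.card N :=
  (Finset.card_eq_sum_card_fiberwise fun _ _ => Finset.mem_univ _).symm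

/-- The load of a resource is the sum of the loads contributed by the blocks of a partition. -/
lemma load_eq_sum_parts [DecidableEq N] (π : Finpartition (Finset.univ : Finset N))
    (a : N → M) (x : M) :
    load a x = ∑ C ∈ π.parts, (C.filter fun i => a i = x).card := by
  have h := Finset.sum_biUnion (f := fun i => if a i = x then 1 else 0) π.disjoint
  rw [π.biUnion_parts] at h
  simpa only [load, Finset.card_filter, id] using h

/-- The total cost, summed over resources instead of players. -/
lemma totalCost_eq_sum_load [Fintype M] (f : ℕ → ℚ) (a : N → M) :
    totalCost f a = ∑ x, (load a x : ℚ) * f (load a x) := by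
  rw [totalCost, ← Finset.sum_fiberwise Finset.univ a]
  refine Finset.sum_congr rfl fun x _ => ?_
  rw [Finset.sum_congr rfl (g := fun _ => f (load a x)), Finset.sum_const, nsmul_eq_mul, load]
  intro i hi
  rw [(Finset.mem_filter.1 hi).2]

variable [Fintype M]

/-- Evenly distributed outcomes minimize the total cost. -/
lemma totalCost_le_of_load_le_succ [Nonempty M] {f : ℕ → ℚ} (hf_mono : ∀ k, f k < f (k + 1))
    (hf_conv : ∀ k, f (k + 1) - f k ≤ f (k + 2) - f (k + 1)) {a : N → M}
    (ha : ∀ x y, load a x ≤ load a y + 1) (a' : N → M) : totalCost f a ≤ totalCost f a' := by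
  obtain ⟨z, hz⟩ := Finite.exists_min (load a)
  set q := load a z
  let g : ℕ → ℚ := fun k => k * f k
  have hg := secant_le_of_monotone_increments (g := g)
    (monotone_increments_mul_self hf_mono hf_conv) q
  have heq : ∀ x, g (load a x) = g q + ((load a x : ℚ) - q) * (g (q + 1) - g q) := by
    intro x
    have h1 := hz x
    have h2 := ha x z
    obtain h | h : load a x = q ∨ load a x = q + 1 := by omega
    · simp [h]
    · simp [h]
  have hsum : ∑ x, (load a x : ℚ) = ∑ x, (load a' x : ℚ) := by
    exact_mod_cast (sum_load a).trans (sum_load a').symm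
  rw [totalCost_eq_sum_load, totalCost_eq_sum_load]
  calc ∑ x, g (load a x) = ∑ x, (g q + ((load a x : ℚ) - q) * (g (q + 1) - g q)) :=
        Finset.sum_congr rfl fun x _ => heq x
    _ = ∑ x, (g q + ((load a' x : ℚ) - q) * (g (q + 1) - g q)) := by
        simp only [Finset.sum_add_distrib, ← Finset.sum_mul, Finset.sum_sub_distrib, hsum]
    _ ≤ ∑ x, g (load a' x) := Finset.sum_le_sum fun x _ => hg _

/-- Evenly distributed outcomes minimize the maximum cost. -/
lemma maxCost_le_of_load_le_succ [Nonempty N] {f : ℕ → ℚ} (hf : Monotone f) {a : N → M}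
    (ha : ∀ x y, load a x ≤ load a y + 1) (a' : N → M) : maxCost f a ≤ maxCost f a' := by
  refine Finset.sup'_le _ _ fun i _ => ?_
  have hpos : 0 < load a (a i) := Finset.card_pos.2 ⟨i, by simp⟩
  obtain ⟨x, hx⟩ : ∃ x, load a (a i) ≤ load a' x := by
    by_contra! h
    have hlt : ∑ x, load a' x < ∑ x, load a x :=
      Finset.sum_lt_sum (fun x _ => by have := h x; have := ha (a i) x; omega)
        ⟨a i, Finset.mem_univ _, h (a i)⟩
    rw [sum_load, sum_load] at hlt
    exact hlt.false
  obtain ⟨j, hj⟩ := Finset.card_pos.1 (hpos.trans_le hx)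
  obtain rfl : a' j = x := (Finset.mem_filter.1 hj).2
  exact (hf hx).trans
    (Finset.le_sup' (fun i => f (load a' (a' i))) (Finset.mem_univ j))

end Load

/-- If `π` is a balanced partition and, inside each block, players spread
evenly (blocks of size divisible by `m` put exactly `|C|/m` players on each resource, and
the block of size `< m` puts at most one player on each resource), then the outcome is
evenly distributed, hence minimizes both the total cost and the maximum cost. -/
theorem balanced_partition_induces_optimal_outcome
    {N M : Type*} [Fintype N] [Fintype M] [DecidableEq N] [DecidableEq M]
    [Nonempty N] [Nonempty M]
    (f : ℕ → ℚ)
    (hf_mono : ∀ k, f k < f (k + 1))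
    (hf_conv : ∀ k, f (k + 1) - f k ≤ f (k + 2) - f (k + 1))
    (π : Finpartition (Finset.univ : Finset N))
    (hbal_sizes : ∀ C ∈ π.parts, Fintype.card M ∣ C.card ∨ C.card < Fintype.card M)
    (hbal_unique : ∀ C ∈ π.parts, ∀ D ∈ π.parts,
        C.card < Fintype.card M → D.card < Fintype.card M → C = D)
    (a : N → M)
    (hfull : ∀ C ∈ π.parts, Fintype.card M ∣ C.card →
        ∀ x : M, (C.filter fun i => a i = x).card = C.card / Fintype.card M)
    (hsmall : ∀ C ∈ π.parts, C.card < Fintype.card M →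
        ∀ x : M, (C.filter fun i => a i = x).card ≤ 1) :
    (∀ x y : M, |(load a x : ℤ) - (load a y : ℤ)| ≤ 1) ∧
    (∀ a' : N → M, totalCost f a ≤ totalCost f a') ∧
    (∀ a' : N → M, maxCost f a ≤ maxCost f a') := by
  have ha : ∀ x y, load a x ≤ load a y + 1 := by
    intro x y
    have hlarge : ∀ C ∈ π.parts, ¬ C.card < Fintype.card M →
        (C.filter fun i => a i = x).card = (C.filter fun i => a i = y).card := by
      intro C hC hlt
      have hdvd := (hbal_sizes C hC).resolve_right hlt
      rw [hfull C hC hdvd, hfull C hC hdvd]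
    rw [load_eq_sum_parts π, load_eq_sum_parts π]
    by_cases h : ∃ C ∈ π.parts, C.card < Fintype.card M
    · obtain ⟨C, hC, hlt⟩ := h
      rw [← Finset.add_sum_erase _ _ hC, ← Finset.add_sum_erase _ _ hC]
      have hrest : ∑ D ∈ π.parts.erase C, (D.filter fun i => a i = x).card =
          ∑ D ∈ π.parts.erase C, (D.filter fun i => a i = y).card := by
        refine Finset.sum_congr rfl fun D hD => ?_
        obtain ⟨hne, hD⟩ := Finset.mem_erase.1 hD
        exact hlarge D hD fun hD' => hne (hbal_unique D hD C hC hD' hlt)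
      have h1 := hsmall C hC hlt x
      omega
    · push Not at h
      exact (Finset.sum_congr rfl fun C hC => hlarge C hC (h C hC).not_gt).le.trans
        (Nat.le_succ _)
  refine ⟨fun x y => ?_, totalCost_le_of_load_le_succ hf_mono hf_conv ha,
    maxCost_le_of_load_le_succ (monotone_nat_of_le_succ fun k => (hf_mono k).le) ha⟩
  have h1 := ha x y
  have h2 := ha y x
  rw [abs_le]
  omega
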